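/- arXiv:1209.1804 — 4 statements merged into one kernel-verified Lean document; each statement's English description precedes it below -/
import Mathlib

section
/- Let τ : (0,∞) → (0,∞) be measurable, bounded above and bounded away from 0 on every bounded interval (0, M], and regularly varying at infinity with index ρ ≥ 0, i.e. for every λ > 0, τ(λx)/τ(x) → λ^ρ as x → ∞. Let κ : ℝ^d → ℂ be measurable with C_1 τ(|ξ|) ≤ |κ(ξ)| ≤ C_2 τ(|ξ|) for all ξ ≠ 0, for constants 0 < C_1 ≤ C_2 < ∞, and set γ(ξ) = ∫ (1/|κ(ξ−η)|)(1/|κ(η)|) dη. Then there is a constant C < ∞ such that 1/|κ(ξ)|² ≤ C γ(ξ)/|ξ|^d for all ξ ≠ 0. -/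
open MeasureTheory ENNReal
open scoped NNReal Pointwise

/-- If `τ` is regularly varying with nonnegative index and locally bounded above and away
from `0`, then `τ (x ‖v‖) ≤ K τ x` for all `v` in the unit ball outside a set of small measure,
uniformly in `x > 0`. -/
theorem exists_measure_dilation_gt_le {E : Type*} [NormedAddCommGroup E] [MeasurableSpace E]
    [BorelSpace E] (μ : Measure E) (hμ : μ (Metric.ball 0 1) ≠ ∞)
    {τ : ℝ → ℝ} (hτ_meas : Measurable τ) (hτ_pos : ∀ x : ℝ, 0 < x → 0 < τ x)
    (hτ_bdd : ∀ M : ℝ, 0 < M → ∃ a b : ℝ, 0 < a ∧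
      ∀ x ∈ Set.Ioc (0 : ℝ) M, a ≤ τ x ∧ τ x ≤ b)
    {ρ : ℝ} (hρ : 0 ≤ ρ)
    (hτ_rv : ∀ l : ℝ, 0 < l →
      Filter.Tendsto (fun x => τ (l * x) / τ x) Filter.atTop (nhds (l ^ ρ)))
    {ε : ℝ≥0∞} (hε : 0 < ε) :
    ∃ K : ℝ, 0 < K ∧ ∀ x : ℝ, 0 < x →
      μ {v | ‖v‖ < 1 ∧ v ≠ 0 ∧ K * τ x < τ (‖v‖ * x)} ≤ ε := by
  have hmeas : ∀ K x : ℝ,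
      MeasurableSet {v : E | ‖v‖ < 1 ∧ v ≠ 0 ∧ K * τ x < τ (‖v‖ * x)} := fun K x =>
    (measurableSet_lt measurable_norm measurable_const).inter
      ((measurableSet_singleton (0 : E)).compl.inter
        (measurableSet_lt measurable_const (hτ_meas.comp (measurable_norm.mul_const x))))
  have hlim : Filter.Tendsto
      (fun x : ℝ => μ {v : E | ‖v‖ < 1 ∧ v ≠ 0 ∧ 2 * τ x < τ (‖v‖ * x)})
      Filter.atTop (nhds (μ ∅)) := by
    refine tendsto_measure_of_tendsto_indicator (B := Metric.ball 0 1) Filter.atTop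
      (fun x => hmeas 2 x) measurableSet_ball hμ
      (Filter.Eventually.of_forall fun x v hv => by simpa using hv.1) fun v => ?_
    by_cases hv : ‖v‖ < 1 ∧ v ≠ 0
    · have hv0 : 0 < ‖v‖ := norm_pos_iff.mpr hv.2
      have hlt : ‖v‖ ^ ρ < 2 :=
        (Real.rpow_le_one hv0.le hv.1.le hρ).trans_lt one_lt_two
      filter_upwards [(hτ_rv _ hv0).eventually_lt_const hlt, Filter.eventually_gt_atTop 0]
        with x hx hx0
      rw [div_lt_iff₀ (hτ_pos x hx0)] at hx
      simp [hx.le]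
    · exact Filter.Eventually.of_forall fun x => by
        simp only [Set.mem_ofPred_eq, Set.mem_empty_iff_false, iff_false]
        exact fun h => hv ⟨h.1, h.2.1⟩
  rw [measure_empty] at hlim
  obtain ⟨X, hX⟩ := Filter.eventually_atTop.mp (hlim.eventually_le_const hε)
  obtain ⟨a, b, ha, hab⟩ := hτ_bdd (max X 1) (by positivity)
  refine ⟨max 2 (b / a), by positivity, fun x hx => ?_⟩
  rcases le_total X x with hXx | hxX
  · refine (measure_mono ?_).trans (hX x hXx)
    exact fun v hv => ⟨hv.1, hv.2.1,
      (mul_le_mul_of_nonneg_right (le_max_left _ _) (hτ_pos x hx).le).trans_lt hv.2.2⟩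
  · suffices h : {v : E | ‖v‖ < 1 ∧ v ≠ 0 ∧ max 2 (b / a) * τ x < τ (‖v‖ * x)} = ∅ by
      simp [h]
    refine Set.eq_empty_of_forall_notMem fun v ⟨hv1, hv0, hv⟩ => hv.not_ge ?_
    have hxM : x ≤ max X 1 := hxX.trans (le_max_left _ _)
    have hvx : ‖v‖ * x ≤ max X 1 := (mul_le_of_le_one_left hx.le hv1.le).trans hxM
    have hvb := (hab _ ⟨mul_pos (norm_pos_iff.mpr hv0) hx, hvx⟩).2
    have hax := (hab x ⟨hx, hxM⟩).1
    have hb : 0 ≤ b := (ha.le.trans hax).trans (hab x ⟨hx, hxM⟩).2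
    calc τ (‖v‖ * x) ≤ b := hvb
      _ = b / a * a := (div_mul_cancel₀ b ha.ne').symm
      _ ≤ b / a * τ x := by gcongr
      _ ≤ max 2 (b / a) * τ x :=
        mul_le_mul_of_nonneg_right (le_max_right _ _) (hτ_pos x hx).le

/-- For a unit vector `e`, deleting from the ball of radius `1 / 4` about `e / 2` the set `A` and
its reflection `e - A` leaves at least half of the ball if `A` is small. -/
theorem half_measure_ball_le_measure_diff_reflection {E : Type*} [NormedAddCommGroup E]
    [NormedSpace ℝ E] [MeasurableSpace E] [BorelSpace E] [FiniteDimensional ℝ E]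
    (μ : Measure E) [μ.IsAddHaarMeasure] (e : E) {A : Set E}
    (hA : μ A ≤ μ (Metric.ball 0 (1 / 4)) / 4) :
    μ (Metric.ball (0 : E) (1 / 4)) / 2 ≤
      μ (Metric.ball ((1 / 2 : ℝ) • e) (1 / 4) \ (A ∪ (fun v => e - v) ⁻¹' A)) := by
  have hpre : μ ((fun v => e - v) ⁻¹' A) = μ A :=
    (Measure.measurePreserving_sub_left μ e).measure_preimage_equiv
      (f := MeasurableEquiv.subLeft e) A
  have hU : μ (A ∪ (fun v => e - v) ⁻¹' A) ≤ μ (Metric.ball (0 : E) (1 / 4)) / 2 :=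
    calc μ (A ∪ (fun v => e - v) ⁻¹' A) ≤ μ A + μ A := by
          simpa only [hpre] using measure_union_le (μ := μ) A ((fun v => e - v) ⁻¹' A)
      _ ≤ μ (Metric.ball 0 (1 / 4)) / 4 + μ (Metric.ball 0 (1 / 4)) / 4 := by gcongr
      _ = μ (Metric.ball 0 (1 / 4)) / 2 := by
          rw [show (4 : ℝ≥0∞) = 2 * 2 by norm_num, div_eq_mul_inv,
            ENNReal.mul_inv (by simp) (by simp), ← mul_assoc, ← div_eq_mul_inv,
            ← div_eq_mul_inv, ENNReal.add_halves]
  refine le_trans ?_ (le_measure_sdiff (μ := μ))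
  rw [Measure.addHaar_ball_center μ ((1 / 2 : ℝ) • e)]
  have hfin : μ (Metric.ball (0 : E) (1 / 4)) / 2 ≠ ∞ :=
    ENNReal.div_ne_top measure_ball_lt_top.ne (by simp)
  refine ENNReal.le_sub_of_add_le_right (ne_top_of_le_ne_top hfin hU) ?_
  calc _ ≤ μ (Metric.ball (0 : E) (1 / 4)) / 2 + μ (Metric.ball (0 : E) (1 / 4)) / 2 := by
        gcongr
    _ = _ := ENNReal.add_halves _

/-- Lemma 7.2: if `τ : (0,∞) → (0,∞)` is measurable, bounded above and away from `0` on
every bounded interval `(0, M]`, and regularly varying at infinity with index `ρ ≥ 0`,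
and if `C₁ τ(|ξ|) ≤ |κ(ξ)| ≤ C₂ τ(|ξ|)` for all `ξ ≠ 0`, then with
`γ(ξ) = ∫ (1/|κ(ξ−η)|)(1/|κ(η)|) dη` there is a constant `C < ∞` such that
`1/|κ(ξ)|² ≤ C γ(ξ)/|ξ|^d` for all `ξ ≠ 0`. -/
theorem stmt_14 (d : ℕ) (τ : ℝ → ℝ) (hτ_meas : Measurable τ)
    (hτ_pos : ∀ x : ℝ, 0 < x → 0 < τ x)
    (hτ_bdd : ∀ M : ℝ, 0 < M → ∃ a b : ℝ, 0 < a ∧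
      ∀ x ∈ Set.Ioc (0 : ℝ) M, a ≤ τ x ∧ τ x ≤ b)
    (ρ : ℝ) (hρ : 0 ≤ ρ)
    (hτ_rv : ∀ l : ℝ, 0 < l →
      Filter.Tendsto (fun x => τ (l * x) / τ x) Filter.atTop (nhds (l ^ ρ)))
    (κ : EuclideanSpace ℝ (Fin d) → ℂ) (hκ_meas : Measurable κ)
    (C₁ C₂ : ℝ) (hC₁ : 0 < C₁) (hC₁₂ : C₁ ≤ C₂)
    (hκ : ∀ ξ : EuclideanSpace ℝ (Fin d), ξ ≠ 0 →
      C₁ * τ ‖ξ‖ ≤ ‖κ ξ‖ ∧ ‖κ ξ‖ ≤ C₂ * τ ‖ξ‖)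
    (γ : EuclideanSpace ℝ (Fin d) → ℝ≥0∞)
    (hγ : ∀ ξ, γ ξ = ∫⁻ η, ENNReal.ofReal (1 / (‖κ (ξ - η)‖ * ‖κ η‖))) :
    ∃ C : ℝ≥0, ∀ ξ : EuclideanSpace ℝ (Fin d), ξ ≠ 0 →
      ENNReal.ofReal (1 / ‖κ ξ‖ ^ 2) ≤ (C : ℝ≥0∞) * γ ξ / ENNReal.ofReal (‖ξ‖ ^ d) := by
  set m : ℝ≥0∞ := volume (Metric.ball (0 : EuclideanSpace ℝ (Fin d)) (1 / 4)) with hm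
  have hm0 : 0 < m := Metric.measure_ball_pos _ _ (by norm_num)
  have hmt : m ≠ ∞ := measure_ball_lt_top.ne
  obtain ⟨K, hK, hbad⟩ := exists_measure_dilation_gt_le
    (volume : Measure (EuclideanSpace ℝ (Fin d))) measure_ball_lt_top.ne hτ_meas hτ_pos hτ_bdd
    hρ hτ_rv (ε := m / 4) (ENNReal.div_pos hm0.ne' (by simp))
  have hC₂ : 0 < C₂ := hC₁.trans_le hC₁₂
  have hM0 : m / 2 ≠ 0 := (ENNReal.div_pos hm0.ne' (by simp)).ne'
  have hMt : m / 2 ≠ ∞ := ENNReal.div_ne_top hmt (by simp)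
  refine ⟨Real.toNNReal ((C₂ * K / C₁) ^ 2) * (m / 2).toNNReal⁻¹, fun ξ hξ => ?_⟩
  have hx : 0 < ‖ξ‖ := norm_pos_iff.mpr hξ
  have ht := hτ_pos _ hx
  set e : EuclideanSpace ℝ (Fin d) := ‖ξ‖⁻¹ • ξ with he
  have hen : ‖e‖ = 1 := norm_smul_inv_norm (𝕜 := ℝ) hξ
  have hxe : ‖ξ‖ • e = ξ := smul_inv_smul₀ hx.ne' ξ
  set A := {v : EuclideanSpace ℝ (Fin d) | ‖v‖ < 1 ∧ v ≠ 0 ∧ K * τ ‖ξ‖ < τ (‖v‖ * ‖ξ‖)}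
  set G := Metric.ball ((1 / 2 : ℝ) • e) (1 / 4) \ (A ∪ (fun v => e - v) ⁻¹' A)
  have hG : m / 2 ≤ volume G :=
    half_measure_ball_le_measure_diff_reflection volume e (hbad _ hx)
  have hhalf : ‖(1 / 2 : ℝ) • e‖ = 1 / 2 := by rw [norm_smul, hen]; norm_num
  have hball : ∀ v, ‖v - (1 / 2 : ℝ) • e‖ < 1 / 4 → ‖v‖ < 1 ∧ v ≠ 0 := by
    intro v hv
    have h1 := norm_sub_norm_le v ((1 / 2 : ℝ) • e)
    have h2 := norm_sub_norm_le ((1 / 2 : ℝ) • e) v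
    rw [norm_sub_rev] at h2
    exact ⟨by linarith, norm_pos_iff.mp (by linarith)⟩
  have hκ_le : ∀ v, ‖v - (1 / 2 : ℝ) • e‖ < 1 / 4 → v ∉ A →
      0 < ‖κ (‖ξ‖ • v)‖ ∧ ‖κ (‖ξ‖ • v)‖ ≤ C₂ * K * τ ‖ξ‖ := by
    intro v hv hvA
    obtain ⟨hv1, hv0⟩ := hball v hv
    have hτv : τ (‖v‖ * ‖ξ‖) ≤ K * τ ‖ξ‖ := not_lt.mp fun h => hvA ⟨hv1, hv0, h⟩
    have hκv := hκ _ (smul_ne_zero hx.ne' hv0)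
    rw [norm_smul, norm_norm, mul_comm ‖ξ‖] at hκv
    refine ⟨(mul_pos hC₁ (hτ_pos _ (mul_pos (norm_pos_iff.mpr hv0) hx))).trans_le hκv.1,
      hκv.2.trans ?_⟩
    rw [mul_assoc]
    gcongr
  have hγ_ge : ENNReal.ofReal (1 / (C₂ * K * τ ‖ξ‖) ^ 2) *
      (ENNReal.ofReal (‖ξ‖ ^ d) * (m / 2)) ≤ γ ξ := by
    calc _ ≤ ENNReal.ofReal (1 / (C₂ * K * τ ‖ξ‖) ^ 2) * volume (‖ξ‖ • G) := by
          rw [Measure.addHaar_smul_of_nonneg _ hx.le, finrank_euclideanSpace_fin]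
          gcongr
      _ = ∫⁻ _ in ‖ξ‖ • G, ENNReal.ofReal (1 / (C₂ * K * τ ‖ξ‖) ^ 2) :=
          (setLIntegral_const _ _).symm
      _ ≤ ∫⁻ η in ‖ξ‖ • G, ENNReal.ofReal (1 / (‖κ (ξ - η)‖ * ‖κ η‖)) := by
          refine setLIntegral_mono (by fun_prop) ?_
          rintro _ ⟨v, ⟨hvb, hvA⟩, rfl⟩
          rw [Metric.mem_ball, dist_eq_norm] at hvb
          have hvb' : ‖(e - v) - (1 / 2 : ℝ) • e‖ < 1 / 4 := by
            rw [show (e - v) - (1 / 2 : ℝ) • e = -(v - (1 / 2 : ℝ) • e) by module, norm_neg]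
            exact hvb
          obtain ⟨h1, h2⟩ := hκ_le v hvb fun h => hvA (Or.inl h)
          obtain ⟨h3, h4⟩ := hκ_le (e - v) hvb' fun h => hvA (Or.inr h)
          rw [smul_sub, hxe] at h3 h4
          simp only
          rw [sq]
          gcongr
      _ ≤ ∫⁻ η, ENNReal.ofReal (1 / (‖κ (ξ - η)‖ * ‖κ η‖)) := setLIntegral_le_lintegral _ _
      _ = γ ξ := (hγ ξ).symm
  have hκξ : 1 / ‖κ ξ‖ ^ 2 ≤ (C₂ * K / C₁) ^ 2 * (1 / (C₂ * K * τ ‖ξ‖) ^ 2) :=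
    calc 1 / ‖κ ξ‖ ^ 2 ≤ 1 / (C₁ * τ ‖ξ‖) ^ 2 := by
          have := (hκ ξ hξ).1
          gcongr
      _ = _ := by field_simp
  have hxd : ENNReal.ofReal (‖ξ‖ ^ d) ≠ 0 :=
    (ENNReal.ofReal_pos.mpr (pow_pos hx d)).ne'
  rw [ENNReal.le_div_iff_mul_le (Or.inl hxd) (Or.inl ENNReal.ofReal_ne_top)]
  have hM : (((m / 2).toNNReal⁻¹ : ℝ≥0) : ℝ≥0∞) = (m / 2)⁻¹ := by
    rw [ENNReal.coe_inv (ENNReal.toNNReal_ne_zero.mpr ⟨hM0, hMt⟩), ENNReal.coe_toNNReal hMt]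
  rw [ENNReal.coe_mul, hM]
  calc ENNReal.ofReal (1 / ‖κ ξ‖ ^ 2) * ENNReal.ofReal (‖ξ‖ ^ d)
      ≤ ENNReal.ofReal ((C₂ * K / C₁) ^ 2) * ENNReal.ofReal (1 / (C₂ * K * τ ‖ξ‖) ^ 2) *
          ENNReal.ofReal (‖ξ‖ ^ d) := by
        rw [← ENNReal.ofReal_mul (sq_nonneg _)]
        gcongr
    _ = ENNReal.ofReal ((C₂ * K / C₁) ^ 2) * (m / 2)⁻¹ *
          (ENNReal.ofReal (1 / (C₂ * K * τ ‖ξ‖) ^ 2) *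
            (ENNReal.ofReal (‖ξ‖ ^ d) * (m / 2))) := by
        rw [show ∀ a b c x y : ℝ≥0∞, a * b * (c * (x * y)) = a * c * x * (y * b) by
          intros; ring, ENNReal.mul_inv_cancel hM0 hMt, mul_one]
    _ ≤ _ := by
        gcongr
        rfl
end

section
/- Let τ : (0,∞) → (0,∞) be nondecreasing with inf τ > 0, and regularly varying at infinity with index ρ satisfying d/2 < ρ < d, i.e. for every λ > 0, τ(λx)/τ(x) → λ^ρ as x → ∞. Define γ(ξ) = ∫_{ℝ^d} dη / (τ(|ξ−η|) τ(|η|)). Then there exist constants C < ∞ and R < ∞ such that γ(ξ) ≤ C |ξ|^d / τ(|ξ|)² for all |ξ| ≥ R. -/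
open MeasureTheory ENNReal

/-- Upper Potter bound: a nondecreasing function whose doubling ratio tends to a limit less than
`2 ^ p` grows at most like `x ^ p`. -/
theorem exists_le_mul_rpow_of_tendsto_doubling {τ : ℝ → ℝ} {a L p : ℝ}
    (hmono : MonotoneOn τ (Set.Ioi 0)) (ha : 0 < a) (hτ : ∀ x, 0 < x → a ≤ τ x)
    (hlim : Filter.Tendsto (fun x => τ (2 * x) / τ x) Filter.atTop (nhds L))
    (hp : 0 ≤ p) (hL : L < 2 ^ p) :
    ∃ R K : ℝ, 0 < R ∧ 0 < K ∧ ∀ y r, R ≤ y → 0 < r → r ≤ y → τ y ≤ K * (y / r) ^ p * τ r := by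
  obtain ⟨R₀, hR₀⟩ := Filter.eventually_atTop.1 (hlim.eventually_lt_const hL)
  set R := max R₀ 1
  have hR : 0 < R := lt_of_lt_of_le one_pos (le_max_right _ _)
  have hpos : ∀ x, 0 < x → 0 < τ x := fun x hx => ha.trans_le (hτ x hx)
  have iter : ∀ (n : ℕ) (r : ℝ), R ≤ r → τ (2 ^ n * r) ≤ ((2 : ℝ) ^ p) ^ n * τ r := by
    intro n r hr
    induction n with
    | zero => simp
    | succ n ih =>
      have hr0 : 0 < r := hR.trans_le hr
      have hle : r ≤ 2 ^ n * r := le_mul_of_one_le_left hr0.le (one_le_pow₀ one_le_two)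
      have h1 := hR₀ (2 ^ n * r) ((le_max_left _ _).trans (hr.trans hle))
      rw [div_lt_iff₀ (hpos _ (by positivity))] at h1
      calc τ (2 ^ (n + 1) * r) = τ (2 * (2 ^ n * r)) := by ring_nf
        _ ≤ 2 ^ p * τ (2 ^ n * r) := h1.le
        _ ≤ 2 ^ p * (((2 : ℝ) ^ p) ^ n * τ r) := by gcongr
        _ = _ := by ring
  have large : ∀ y r, R ≤ r → r ≤ y → τ y ≤ 2 ^ p * (y / r) ^ p * τ r := by
    intro y r hr hry
    have hr0 : 0 < r := hR.trans_le hr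
    have hy0 : 0 < y := hr0.trans_le hry
    obtain ⟨n, hn1, hn2⟩ := exists_nat_pow_near ((one_le_div hr0).2 hry) one_lt_two
    rw [div_lt_iff₀ hr0] at hn2
    have hτr := hpos r hr0
    calc τ y ≤ τ (2 ^ (n + 1) * r) := hmono hy0 (Set.mem_Ioi.2 (by positivity)) hn2.le
      _ ≤ ((2 : ℝ) ^ p) ^ (n + 1) * τ r := iter _ _ hr
      _ = 2 ^ p * ((2 : ℝ) ^ n) ^ p * τ r := by
        rw [pow_succ, ← Real.rpow_mul_natCast two_pos.le, mul_comm p, Real.rpow_natCast_mul two_pos.le]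
        ring
      _ ≤ 2 ^ p * (y / r) ^ p * τ r := by gcongr
  refine ⟨R, 2 ^ p * (τ R / a), hR, mul_pos (by positivity) (div_pos (hpos R hR) ha), ?_⟩
  intro y r hy hr hry
  have hy0 : 0 < y := hR.trans_le hy
  have hτr := hpos r hr
  have hτR := hpos R hR
  have h1 : 1 ≤ τ R / a := (one_le_div ha).2 (hτ R hR)
  rcases le_total R r with h | h
  · calc τ y ≤ 2 ^ p * 1 * (y / r) ^ p * τ r := by simpa using large y r h hry
      _ ≤ 2 ^ p * (τ R / a) * (y / r) ^ p * τ r := by gcongr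
  · calc τ y ≤ 2 ^ p * (y / R) ^ p * τ R := large y R le_rfl hy
      _ ≤ 2 ^ p * (y / r) ^ p * τ R := by gcongr
      _ = 2 ^ p * (τ R / a) * (y / r) ^ p * a := by field_simp
      _ ≤ 2 ^ p * (τ R / a) * (y / r) ^ p * τ r := by gcongr; exact hτ r hr

/-- Lower Potter bound: a nondecreasing positive function whose doubling ratio tends to a limit
greater than `2 ^ q` grows at least like `x ^ q`. -/
theorem exists_rpow_mul_le_of_tendsto_doubling {τ : ℝ → ℝ} {L q : ℝ}
    (hmono : MonotoneOn τ (Set.Ioi 0)) (hpos : ∀ x, 0 < x → 0 < τ x)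
    (hlim : Filter.Tendsto (fun x => τ (2 * x) / τ x) Filter.atTop (nhds L))
    (hq : 0 ≤ q) (hL : 2 ^ q < L) :
    ∃ R K : ℝ, 0 < R ∧ 0 < K ∧ ∀ y r, R ≤ y → y ≤ r → (r / y) ^ q * τ y ≤ K * τ r := by
  obtain ⟨R₀, hR₀⟩ := Filter.eventually_atTop.1 (hlim.eventually_const_lt hL)
  set R := max R₀ 1
  have hR : 0 < R := lt_of_lt_of_le one_pos (le_max_right _ _)
  have iter : ∀ (n : ℕ) (r : ℝ), R ≤ r → ((2 : ℝ) ^ q) ^ n * τ r ≤ τ (2 ^ n * r) := by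
    intro n r hr
    induction n with
    | zero => simp
    | succ n ih =>
      have hr0 : 0 < r := hR.trans_le hr
      have hle : r ≤ 2 ^ n * r := le_mul_of_one_le_left hr0.le (one_le_pow₀ one_le_two)
      have h1 := hR₀ (2 ^ n * r) ((le_max_left _ _).trans (hr.trans hle))
      rw [lt_div_iff₀ (hpos _ (by positivity))] at h1
      calc ((2 : ℝ) ^ q) ^ (n + 1) * τ r = 2 ^ q * (((2 : ℝ) ^ q) ^ n * τ r) := by ring
        _ ≤ 2 ^ q * τ (2 ^ n * r) := by gcongr
        _ ≤ τ (2 * (2 ^ n * r)) := h1.le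
        _ = _ := by ring_nf
  refine ⟨R, 2 ^ q, hR, by positivity, ?_⟩
  intro y r hy hyr
  have hy0 : 0 < y := hR.trans_le hy
  have hr0 : 0 < r := hy0.trans_le hyr
  obtain ⟨n, hn1, hn2⟩ := exists_nat_pow_near ((one_le_div hy0).2 hyr) one_lt_two
  rw [le_div_iff₀ hy0] at hn1
  have hτy := hpos y hy0
  calc (r / y) ^ q * τ y ≤ ((2 : ℝ) ^ (n + 1)) ^ q * τ y := by gcongr
    _ = 2 ^ q * (((2 : ℝ) ^ q) ^ n * τ y) := by
      rw [← Real.rpow_natCast_mul two_pos.le, mul_comm _ q, Real.rpow_mul_natCast two_pos.le,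
        pow_succ]
      ring
    _ ≤ 2 ^ q * τ (2 ^ n * y) := by gcongr; exact iter n y hy
    _ ≤ 2 ^ q * τ r := by
      gcongr
      exact hmono (Set.mem_Ioi.2 (by positivity)) hr0 hn1

/-- The radial profile equal to `r ^ (-p)` near the origin and to `r ^ (-s)` at infinity. -/
noncomputable def twoPowerProfile (p s r : ℝ) : ℝ :=
  if r ≤ 1 then r ^ (-p) else r ^ (-s)

theorem twoPowerProfile_nonneg {p s r : ℝ} (hr : 0 ≤ r) : 0 ≤ twoPowerProfile p s r := by
  unfold twoPowerProfile
  split_ifs <;> positivity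

theorem integrable_twoPowerProfile_norm {d : ℕ} {p s : ℝ} (hd : 0 < d) (hp : p < d)
    (hs : d < s) :
    Integrable (fun η : EuclideanSpace ℝ (Fin d) => twoPowerProfile p s ‖η‖) := by
  have : Nonempty (Fin d) := ⟨⟨0, hd⟩⟩
  have hcast : ((d - 1 : ℕ) : ℝ) = d - 1 := by
    rw [Nat.cast_sub hd, Nat.cast_one]
  rw [integrable_fun_norm_addHaar volume (f := twoPowerProfile p s), finrank_euclideanSpace_fin,
    ← Set.Ioc_union_Ioi_eq_Ioi (zero_le_one' ℝ)]
  refine IntegrableOn.union ?_ ?_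
  · have h : IntegrableOn (fun r : ℝ => r ^ ((d : ℝ) - 1 - p)) (Set.Ioc 0 1) :=
      (intervalIntegrable_iff_integrableOn_Ioc_of_le zero_le_one).1
        (intervalIntegral.intervalIntegrable_rpow' (by linarith))
    refine h.congr_fun (fun r hr => ?_) measurableSet_Ioc
    simp only [twoPowerProfile, if_pos hr.2, smul_eq_mul]
    rw [← Real.rpow_natCast, hcast, ← Real.rpow_add hr.1, sub_eq_add_neg]
  · have h : IntegrableOn (fun r : ℝ => r ^ ((d : ℝ) - 1 - s)) (Set.Ioi 1) :=
      integrableOn_Ioi_rpow_of_lt (by linarith) one_pos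
    refine h.congr_fun (fun r hr => ?_) measurableSet_Ioi
    have hr1 : (1 : ℝ) < r := hr
    simp only [twoPowerProfile, if_neg (not_le.2 hr1), smul_eq_mul]
    rw [← Real.rpow_natCast, hcast, ← Real.rpow_add (one_pos.trans hr1), sub_eq_add_neg]

/-- Potter bounds around scale `y` control the product of the values of `1 / τ` at two radii, the
larger of which is at least `y`, by the profile of the smaller one. -/
theorem one_div_mul_le_twoPowerProfile {τ : ℝ → ℝ} {p q y K K' m n : ℝ}
    (hmono : MonotoneOn τ (Set.Ioi 0)) (hpos : ∀ x, 0 < x → 0 < τ x) (hy : 0 < y)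
    (hK : 0 < K) (hK' : 0 < K')
    (hU : ∀ r, 0 < r → r ≤ y → τ y ≤ K * (y / r) ^ p * τ r)
    (hL : ∀ r, y ≤ r → (r / y) ^ q * τ y ≤ K' * τ r)
    (hm : 0 < m) (hmn : m ≤ n) (hyn : y ≤ n) :
    1 / (τ n * τ m) ≤ (K + K' ^ 2) / τ y ^ 2 * twoPowerProfile p (2 * q) (m / y) := by
  have hτm := hpos m hm
  have hτy := hpos y hy
  have hn := hm.trans_le hmn
  have hτn := hpos n hn
  unfold twoPowerProfile
  split_ifs with h
  · have hmy : m ≤ y := (div_le_one hy).1 h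
    have h1 : τ y ≤ K * (y / m) ^ p * τ m := hU m hm hmy
    have h2 : τ y ≤ τ n := hmono hy hn hyn
    rw [Real.rpow_neg (by positivity), ← Real.inv_rpow (by positivity), inv_div]
    have hk : 0 < (y / m) ^ p := by positivity
    rw [div_mul_eq_mul_div, div_le_div_iff₀ (by positivity) (by positivity)]
    calc 1 * τ y ^ 2 = τ y * τ y := by ring
      _ ≤ τ n * (K * (y / m) ^ p * τ m) := by gcongr
      _ = K * (y / m) ^ p * (τ n * τ m) := by ring
      _ ≤ (K + K' ^ 2) * (y / m) ^ p * (τ n * τ m) := by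
        gcongr
        exact le_add_of_nonneg_right (by positivity)
  · have hmy : y ≤ m := ((one_lt_div hy).1 (not_le.1 h)).le
    have h1 := hL m hmy
    have h2 : τ m ≤ τ n := hmono hm hn hmn
    have hk : 0 < (m / y) ^ q := by positivity
    rw [Real.rpow_neg (by positivity), mul_comm 2 q, Real.rpow_mul (by positivity),
      Real.rpow_two, ← div_eq_mul_inv, div_div, div_le_div_iff₀ (by positivity) (by positivity)]
    calc 1 * (τ y ^ 2 * ((m / y) ^ q) ^ 2) = ((m / y) ^ q * τ y) ^ 2 := by ring
      _ ≤ (K' * τ m) ^ 2 := by gcongr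
      _ = K' ^ 2 * (τ m * τ m) := by ring
      _ ≤ (K + K' ^ 2) * (τ n * τ m) := by
        gcongr
        exact le_add_of_nonneg_left hK.le

/-- Lemma 7.3: if `τ : (0,∞) → (0,∞)` is nondecreasing, bounded away from `0`, and
regularly varying at infinity with index `ρ ∈ (d/2, d)`, then the convolution
`γ(ξ) = ∫ dη / (τ(|ξ−η|) τ(|η|))` satisfies `γ(ξ) ≤ C |ξ|^d / τ(|ξ|)²` for all `|ξ|`
sufficiently large. -/
theorem stmt_15 (d : ℕ) (τ : ℝ → ℝ)
    (hτ_mono : MonotoneOn τ (Set.Ioi (0 : ℝ)))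
    (hτ_pos : ∃ a : ℝ, 0 < a ∧ ∀ x : ℝ, 0 < x → a ≤ τ x)
    (ρ : ℝ) (hρ₁ : (d : ℝ) / 2 < ρ) (hρ₂ : ρ < d)
    (hτ_rv : ∀ l : ℝ, 0 < l →
      Filter.Tendsto (fun x => τ (l * x) / τ x) Filter.atTop (nhds (l ^ ρ)))
    (γ : EuclideanSpace ℝ (Fin d) → ℝ≥0∞)
    (hγ : ∀ ξ, γ ξ = ∫⁻ η, ENNReal.ofReal (1 / (τ ‖ξ - η‖ * τ ‖η‖))) :
    ∃ C R : ℝ, 0 ≤ C ∧ ∀ ξ : EuclideanSpace ℝ (Fin d), R ≤ ‖ξ‖ →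
      γ ξ ≤ ENNReal.ofReal (C * ‖ξ‖ ^ d / τ ‖ξ‖ ^ 2) := by
  obtain ⟨a, ha, hτa⟩ := hτ_pos
  have hpos : ∀ x, 0 < x → 0 < τ x := fun x hx => ha.trans_le (hτa x hx)
  have hd : 0 < d := by
    have : (0 : ℝ) < d := by linarith
    exact_mod_cast this
  obtain ⟨p, hp1, hp2⟩ := exists_between hρ₂
  obtain ⟨q, hq1, hq2⟩ := exists_between hρ₁
  have hd0 : (0 : ℝ) ≤ d := d.cast_nonneg
  obtain ⟨R₁, K, hR₁, hK, hU⟩ := exists_le_mul_rpow_of_tendsto_doubling hτ_mono ha hτa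
    (hτ_rv 2 two_pos) (by linarith) (Real.rpow_lt_rpow_of_exponent_lt one_lt_two hp1)
  obtain ⟨R₂, K', hR₂, hK', hL⟩ := exists_rpow_mul_le_of_tendsto_doubling hτ_mono hpos
    (hτ_rv 2 two_pos) (by linarith) (Real.rpow_lt_rpow_of_exponent_lt one_lt_two hq2)
  set k := twoPowerProfile p (2 * q)
  have hkint : Integrable (fun η : EuclideanSpace ℝ (Fin d) => k ‖η‖) :=
    integrable_twoPowerProfile_norm hd hp2 (by linarith)
  set I := ∫ η : EuclideanSpace ℝ (Fin d), k ‖η‖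
  have hI0 : 0 ≤ I := integral_nonneg fun η => twoPowerProfile_nonneg (norm_nonneg η)
  refine ⟨2 * (K + K' ^ 2) * I * (K * 2 ^ p) ^ 2, 2 * max R₁ R₂, by positivity, fun ξ hξ => ?_⟩
  set y := ‖ξ‖ / 2 with hy
  have hyR₁ : R₁ ≤ y := by linarith [le_max_left R₁ R₂]
  have hyR₂ : R₂ ≤ y := by linarith [le_max_right R₁ R₂]
  have hy0 : 0 < y := hR₁.trans_le hyR₁
  have hξy : ‖ξ‖ = 2 * y := by rw [hy]; ring
  have hτy := hpos y hy0
  set A := (K + K' ^ 2) / τ y ^ 2 with hA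
  have hA0 : 0 ≤ A := by positivity
  have hg : Integrable (fun η : EuclideanSpace ℝ (Fin d) => k (‖η‖ / y)) := by
    have := hkint.comp_smul (inv_ne_zero hy0.ne')
    simpa [norm_smul, abs_of_pos hy0, div_eq_inv_mul] using this
  have hgI : ∫ η : EuclideanSpace ℝ (Fin d), k (‖η‖ / y) = y ^ d * I := by
    have := Measure.integral_comp_inv_smul_of_nonneg volume
      (fun η : EuclideanSpace ℝ (Fin d) => k ‖η‖) hy0.le
    simpa [norm_smul, abs_of_pos hy0, div_eq_inv_mul] using this
  have hgt : Integrable (fun η => k (‖ξ - η‖ / y)) := hg.comp_sub_left ξ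
  have hgtI : ∫ η, k (‖ξ - η‖ / y) = y ^ d * I := by
    rw [← hgI]
    exact integral_sub_left_eq_self (fun η => k (‖η‖ / y)) volume ξ
  have hkn : ∀ η : EuclideanSpace ℝ (Fin d), 0 ≤ k (‖η‖ / y) := fun η =>
    twoPowerProfile_nonneg (by positivity)
  have : Nonempty (Fin d) := ⟨⟨0, hd⟩⟩
  have hpt : ∀ᵐ η : EuclideanSpace ℝ (Fin d),
      1 / (τ ‖ξ - η‖ * τ ‖η‖) ≤ A * (k (‖η‖ / y) + k (‖ξ - η‖ / y)) := by
    filter_upwards [Measure.ae_ne volume (0 : EuclideanSpace ℝ (Fin d)),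
      Measure.ae_ne volume ξ] with η h0 hξη
    have hη : 0 < ‖η‖ := norm_pos_iff.2 h0
    have hξη' : 0 < ‖ξ - η‖ := norm_pos_iff.2 (sub_ne_zero.2 hξη.symm)
    have htri : 2 * y ≤ ‖ξ - η‖ + ‖η‖ := by
      rw [← hξy]
      simpa using norm_add_le (ξ - η) η
    have key : ∀ m n : ℝ, 0 < m → m ≤ n → y ≤ n → 1 / (τ n * τ m) ≤ A * k (m / y) :=
      fun m n hm hmn hyn => one_div_mul_le_twoPowerProfile hτ_mono hpos hy0 hK hK'
        (fun r => hU y r hyR₁) (fun r => hL y r hyR₂) hm hmn hyn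
    rcases le_total ‖η‖ ‖ξ - η‖ with h | h
    · refine (key _ _ hη h (by linarith)).trans ?_
      gcongr
      exact le_add_of_nonneg_right (hkn _)
    · rw [mul_comm (τ _)]
      refine (key _ _ hξη' h (by linarith)).trans ?_
      gcongr
      exact le_add_of_nonneg_left (hkn _)
  have hdouble : τ ‖ξ‖ ≤ K * 2 ^ p * τ y := by
    have := hU (2 * y) y (by linarith) hy0 (by linarith)
    rwa [mul_div_cancel_right₀ _ hy0.ne', ← hξy] at this
  have hτξ : 0 < τ ‖ξ‖ := hpos _ (by linarith)
  calc γ ξ = ∫⁻ η, ENNReal.ofReal (1 / (τ ‖ξ - η‖ * τ ‖η‖)) := hγ ξ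
    _ ≤ ∫⁻ η, ENNReal.ofReal (A * (k (‖η‖ / y) + k (‖ξ - η‖ / y))) :=
      lintegral_mono_ae (hpt.mono fun η h => ENNReal.ofReal_le_ofReal h)
    _ = ENNReal.ofReal (∫ η, A * (k (‖η‖ / y) + k (‖ξ - η‖ / y))) :=
      (ofReal_integral_eq_lintegral_ofReal ((hg.add hgt).const_mul A)
        (ae_of_all _ fun η => mul_nonneg hA0 (add_nonneg (hkn _) (hkn _)))).symm
    _ = ENNReal.ofReal (A * (2 * (y ^ d * I))) := by
      rw [integral_const_mul, integral_add hg hgt, hgI, hgtI, ← two_mul]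
    _ ≤ _ := by
      apply ENNReal.ofReal_le_ofReal
      have hyξ : y ≤ ‖ξ‖ := by linarith
      rw [hA, div_mul_eq_mul_div, div_le_div_iff₀ (by positivity) (by positivity)]
      calc (K + K' ^ 2) * (2 * (y ^ d * I)) * τ ‖ξ‖ ^ 2
          ≤ (K + K' ^ 2) * (2 * (‖ξ‖ ^ d * I)) * (K * 2 ^ p * τ y) ^ 2 := by gcongr
        _ = _ := by ring
end

section
/- Let τ : (0,∞) → (0,∞) be nondecreasing with inf τ > 0 and regularly varying at infinity with index ρ > 0, and let κ : ℝ^d → ℂ be measurable with C_1 τ(|ξ|) ≤ |κ(ξ)| ≤ C_2 τ(|ξ|) for all ξ ≠ 0, for constants 0 < C_1 ≤ C_2 < ∞. Assume also that ∫_{ℝ^d} e^{−Re κ(λ)} dλ < ∞. Then there is a constant C < ∞ such that for every s ∈ ℝ^d, ∫ (1/|κ(s+λ)|) (1/|κ(λ)|) e^{−Re κ(λ)} dλ ≤ C / |κ(s)|. -/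
open MeasureTheory ENNReal
open scoped NNReal

/-- A nondecreasing function on `(0, ∞)` that is bounded away from `0` and for which
`τ (2 * x) / τ x` converges at infinity satisfies a doubling inequality on all of `(0, ∞)`. -/
theorem exists_doubling_of_monotoneOn {τ : ℝ → ℝ} (hmono : MonotoneOn τ (Set.Ioi (0 : ℝ)))
    {a : ℝ} (ha : 0 < a) (hτ : ∀ x : ℝ, 0 < x → a ≤ τ x) {L : ℝ}
    (hlim : Filter.Tendsto (fun x => τ (2 * x) / τ x) Filter.atTop (nhds L)) :
    ∃ K : ℝ, 0 < K ∧ ∀ x : ℝ, 0 < x → τ (2 * x) ≤ K * τ x := by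
  obtain ⟨X, hX⟩ := Filter.eventually_atTop.1 (hlim.eventually_le_const (lt_add_one L))
  set Y := max X 1
  have hY : 0 < Y := lt_of_lt_of_le one_pos (le_max_right _ _)
  have hτY : 0 < τ (2 * Y) := ha.trans_le (hτ _ (by positivity))
  refine ⟨max (L + 1) (τ (2 * Y) / a), lt_max_of_lt_right (by positivity), fun x hx => ?_⟩
  have hτx : 0 < τ x := ha.trans_le (hτ x hx)
  rcases le_total Y x with h | h
  · have h1 : τ (2 * x) ≤ (L + 1) * τ x :=
      (div_le_iff₀ hτx).1 (hX x ((le_max_left _ _).trans h))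
    exact h1.trans (mul_le_mul_of_nonneg_right (le_max_left _ _) hτx.le)
  · calc τ (2 * x) ≤ τ (2 * Y) :=
          hmono (by simpa using hx) (by simpa using hY) (by linarith)
      _ = τ (2 * Y) / a * a := by field_simp
      _ ≤ max (L + 1) (τ (2 * Y) / a) * τ x := by
          gcongr
          · exact le_max_right _ _
          · exact hτ x hx

/-- For a nondecreasing doubling function bounded below by `a > 0`, the value at the norm of `x`
is controlled by the product of the values at the norms of `x + y` and `y`. -/
theorem mul_le_mul_mul_of_doubling {E : Type*} [NormedAddCommGroup E] {τ : ℝ → ℝ}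
    (hmono : MonotoneOn τ (Set.Ioi (0 : ℝ))) {a K : ℝ} (ha : 0 < a)
    (hτ : ∀ x : ℝ, 0 < x → a ≤ τ x) (hK : 0 < K)
    (hdouble : ∀ x : ℝ, 0 < x → τ (2 * x) ≤ K * τ x)
    {x y : E} (hx : x ≠ 0) (hxy : x + y ≠ 0) (hy : y ≠ 0) :
    a * τ ‖x‖ ≤ K * (τ ‖x + y‖ * τ ‖y‖) := by
  have hx := norm_pos_iff.2 hx
  have hxy := norm_pos_iff.2 hxy
  have hy := norm_pos_iff.2 hy
  have htri : ‖x‖ ≤ ‖x + y‖ + ‖y‖ := by simpa using norm_sub_le (x + y) y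
  have key : ∀ p q : ℝ, 0 < p → 0 < q → ‖x‖ ≤ 2 * p → a * τ ‖x‖ ≤ K * (τ p * τ q) := by
    intro p q hp hq h
    have h1 : τ ‖x‖ ≤ K * τ p :=
      (hmono hx (show 0 < 2 * p by positivity) h).trans (hdouble p hp)
    have h2 : 0 ≤ K * τ p := mul_nonneg hK.le (ha.le.trans (hτ p hp))
    calc a * τ ‖x‖ ≤ a * (K * τ p) := by gcongr
      _ ≤ τ q * (K * τ p) := mul_le_mul_of_nonneg_right (hτ q hq) h2
      _ = K * (τ p * τ q) := by ring
  rcases le_total ‖y‖ ‖x + y‖ with h | h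
  · exact key _ _ hxy hy (by linarith)
  · rw [mul_comm (τ ‖x + y‖)]
    exact key _ _ hy hxy (by linarith)

/-- If `‖f s‖ ≤ D * (‖f (s + l)‖ * ‖f l‖)` for almost every `l`, then integrating a weight against
`1 / (‖f (s + l)‖ * ‖f l‖)` gains the factor `1 / ‖f s‖`. -/
theorem lintegral_div_mul_le_of_ae {E F : Type*} [Add E] [MeasurableSpace E] {μ : Measure E}
    [NormedAddCommGroup F] {f : E → F} {w : E → ℝ≥0∞} {D : ℝ≥0} {s : E} (hs : f s ≠ 0)
    (h : ∀ᵐ l ∂μ, ‖f s‖₊ ≤ D * (‖f (s + l)‖₊ * ‖f l‖₊)) :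
    ∫⁻ l, w l / ((‖f (s + l)‖₊ : ℝ≥0∞) * (‖f l‖₊ : ℝ≥0∞)) ∂μ
      ≤ (∫⁻ l, w l ∂μ) * D / (‖f s‖₊ : ℝ≥0∞) := by
  have hs0 : (‖f s‖₊ : ℝ≥0∞) ≠ 0 := by simpa using hs
  have hc : (D : ℝ≥0∞) / ‖f s‖₊ ≠ ⊤ := ENNReal.div_ne_top ENNReal.coe_ne_top hs0
  calc ∫⁻ l, w l / ((‖f (s + l)‖₊ : ℝ≥0∞) * (‖f l‖₊ : ℝ≥0∞)) ∂μ
      ≤ ∫⁻ l, w l * ((D : ℝ≥0∞) / ‖f s‖₊) ∂μ := by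
        refine lintegral_mono_ae ?_
        filter_upwards [h] with l hl
        rw [div_eq_mul_inv]
        gcongr
        rw [← ENNReal.coe_mul]
        have hprod : ‖f (s + l)‖₊ * ‖f l‖₊ ≠ 0 := by
          intro h0
          rw [h0, mul_zero] at hl
          exact hs (nnnorm_eq_zero.1 (nonpos_iff_eq_zero.1 hl))
        rw [ENNReal.le_div_iff_mul_le (Or.inl hs0) (Or.inl ENNReal.coe_ne_top),
          ← ENNReal.coe_inv hprod, ← ENNReal.coe_mul, ENNReal.coe_le_coe, mul_comm,
          ← div_eq_mul_inv, div_le_iff₀ (pos_iff_ne_zero.2 hprod)]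
        exact hl
    _ = (∫⁻ l, w l ∂μ) * D / (‖f s‖₊ : ℝ≥0∞) := by
        rw [lintegral_mul_const' _ _ hc, mul_div_assoc]

/-- Estimate (7.11): if `τ : (0,∞) → (0,∞)` is nondecreasing, bounded away from `0`, and
regularly varying at infinity with index `ρ > 0`, `C₁ τ(|ξ|) ≤ |κ(ξ)| ≤ C₂ τ(|ξ|)` for
all `ξ ≠ 0`, and `∫ e^{−Re κ(λ)} dλ < ∞`, then there is a constant `C < ∞` such that for
every `s`, `∫ (1/|κ(s+λ)|)(1/|κ(λ)|) e^{−Re κ(λ)} dλ ≤ C / |κ(s)|`. -/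
theorem stmt_17 (d : ℕ) (τ : ℝ → ℝ)
    (hτ_mono : MonotoneOn τ (Set.Ioi (0 : ℝ)))
    (hτ_pos : ∃ a : ℝ, 0 < a ∧ ∀ x : ℝ, 0 < x → a ≤ τ x)
    (ρ : ℝ) (hρ : 0 < ρ)
    (hτ_rv : ∀ l : ℝ, 0 < l →
      Filter.Tendsto (fun x => τ (l * x) / τ x) Filter.atTop (nhds (l ^ ρ)))
    (κ : EuclideanSpace ℝ (Fin d) → ℂ) (hκ_meas : Measurable κ)
    (C₁ C₂ : ℝ) (hC₁ : 0 < C₁) (hC₁₂ : C₁ ≤ C₂)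
    (hκ : ∀ ξ : EuclideanSpace ℝ (Fin d), ξ ≠ 0 →
      C₁ * τ ‖ξ‖ ≤ ‖κ ξ‖ ∧ ‖κ ξ‖ ≤ C₂ * τ ‖ξ‖)
    (hexp : ∫⁻ l, ENNReal.ofReal (Real.exp (-(κ l).re)) < ⊤) :
    ∃ C : ℝ≥0, ∀ s : EuclideanSpace ℝ (Fin d),
      ∫⁻ l, ENNReal.ofReal (Real.exp (-(κ l).re)) /
          ((‖κ (s + l)‖₊ : ℝ≥0∞) * (‖κ l‖₊ : ℝ≥0∞))
        ≤ (C : ℝ≥0∞) / (‖κ s‖₊ : ℝ≥0∞) := by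
  obtain ⟨a, ha, hτ⟩ := hτ_pos
  obtain ⟨K, hK, hdouble⟩ := exists_doubling_of_monotoneOn hτ_mono ha hτ (hτ_rv 2 two_pos)
  have hC₂ : 0 < C₂ := hC₁.trans_le hC₁₂
  have hlower : ∀ ξ : EuclideanSpace ℝ (Fin d), ξ ≠ 0 → C₁ * a ≤ ‖κ ξ‖ := fun ξ hξ =>
    (mul_le_mul_of_nonneg_left (hτ _ (norm_pos_iff.2 hξ)) hC₁.le).trans (hκ ξ hξ).1
  obtain ⟨D, hD⟩ : ∃ D : ℝ≥0, ∀ s, κ s ≠ 0 →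
      ∀ᵐ l, ‖κ s‖₊ ≤ D * (‖κ (s + l)‖₊ * ‖κ l‖₊) := by
    set m := min (C₁ * a) ‖κ 0‖
    set D₁ := C₂ * K / (a * C₁ ^ 2)
    refine ⟨(max D₁ (‖κ 0‖ / m ^ 2)).toNNReal, fun s hs => ?_⟩
    have hcoe : ((max D₁ (‖κ 0‖ / m ^ 2)).toNNReal : ℝ) = max D₁ (‖κ 0‖ / m ^ 2) :=
      Real.coe_toNNReal _ (le_max_of_le_left (by positivity))
    by_cases hs0 : s = 0
    · subst hs0
      have hm : 0 < m := lt_min (by positivity) (norm_pos_iff.2 hs)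
      have hκm : ∀ l, m ≤ ‖κ l‖ := fun l => by
        by_cases hl : l = 0
        · exact hl ▸ min_le_right _ _
        · exact (min_le_left _ _).trans (hlower l hl)
      refine Filter.Eventually.of_forall fun l => ?_
      rw [← NNReal.coe_le_coe]
      push_cast
      rw [hcoe, zero_add]
      calc ‖κ 0‖ = ‖κ 0‖ / m ^ 2 * (m * m) := by field_simp
        _ ≤ max D₁ (‖κ 0‖ / m ^ 2) * (‖κ l‖ * ‖κ l‖) := by
          gcongr
          · exact le_max_right _ _
          · exact hκm l
          · exact hκm l
    · have : Nontrivial (EuclideanSpace ℝ (Fin d)) := ⟨⟨s, 0, hs0⟩⟩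
      filter_upwards [Measure.ae_ne volume (0 : EuclideanSpace ℝ (Fin d)),
        Measure.ae_ne volume (-s)] with l hl hsl
      have hsl : s + l ≠ 0 := fun h => hsl (eq_neg_of_add_eq_zero_right h)
      have hmul := mul_le_mul_mul_of_doubling hτ_mono ha hτ hK hdouble hs0 hsl hl
      have hτsl := ha.trans_le (hτ _ (norm_pos_iff.2 hsl))
      have hτl := ha.trans_le (hτ _ (norm_pos_iff.2 hl))
      rw [← NNReal.coe_le_coe]
      push_cast
      rw [hcoe]
      calc ‖κ s‖ ≤ C₂ * τ ‖s‖ := (hκ s hs0).2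
        _ = C₂ / a * (a * τ ‖s‖) := by field_simp
        _ ≤ C₂ / a * (K * (τ ‖s + l‖ * τ ‖l‖)) := by gcongr
        _ = D₁ * ((C₁ * τ ‖s + l‖) * (C₁ * τ ‖l‖)) := by simp only [D₁]; field_simp
        _ ≤ max D₁ (‖κ 0‖ / m ^ 2) * (‖κ (s + l)‖ * ‖κ l‖) := by
          gcongr
          · exact le_max_left _ _
          · exact (hκ _ hsl).1
          · exact (hκ _ hl).1
  set J := ∫⁻ l, ENNReal.ofReal (Real.exp (-(κ l).re))
  refine ⟨(J * D).toNNReal + 1, fun s => ?_⟩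
  by_cases hs : κ s = 0
  · simp [hs, ENNReal.div_zero]
  · refine (lintegral_div_mul_le_of_ae hs (hD s hs)).trans ?_
    rw [ENNReal.coe_add, ENNReal.coe_toNNReal (ENNReal.mul_ne_top hexp.ne ENNReal.coe_ne_top)]
    gcongr
    exact le_self_add
end

section
/- Let u, h : ℝ^d → ℝ be continuous integrable functions whose Fourier transforms û, ĥ are integrable, so that u and h are recovered by Fourier inversion, and let ν be a finite signed Borel measure on ℝ^d with Fourier transform ν̂(ξ) = ∫ e^{−i⟨ξ,z⟩} dν(z). Then sup_{x,y ∈ ℝ^d} |∫ u(z−y) h(x−z) dν(z)| ≤ (2π)^{−d} ∫ |ν̂(s)| (∫ |û(s+λ)| |ĥ(λ)| dλ) ds. -/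
open MeasureTheory ENNReal
open scoped RealInnerProductSpace NNReal

/-- The Fourier transform of `g • μ` is measurable. -/
lemma measurable_integral_cexp_neg_inner_mul {d : ℕ}
    (μ : Measure (EuclideanSpace ℝ (Fin d))) [SFinite μ]
    {g : EuclideanSpace ℝ (Fin d) → ℝ} (hg : Measurable g) :
    Measurable fun ξ : EuclideanSpace ℝ (Fin d) =>
      ∫ z, Complex.exp (-(Complex.I * ((⟪ξ, z⟫ : ℝ) : ℂ))) * (g z : ℂ) ∂μ := by
  have hm : Measurable fun p : EuclideanSpace ℝ (Fin d) × EuclideanSpace ℝ (Fin d) =>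
      Complex.exp (-(Complex.I * ((⟪p.1, p.2⟫ : ℝ) : ℂ))) * (g p.2 : ℂ) := by
    refine Measurable.mul (Continuous.measurable (by fun_prop)) ?_
    exact Complex.measurable_ofReal.comp (hg.comp measurable_snd)
  exact (hm.stronglyMeasurable.integral_prod_right (ν := μ)).measurable

/-- The modulus of the Fourier transform of a real signed measure is even. -/
lemma norm_integral_cexp_neg_inner_mul_neg {d : ℕ}
    (μ : Measure (EuclideanSpace ℝ (Fin d)))
    (g : EuclideanSpace ℝ (Fin d) → ℝ) (ξ : EuclideanSpace ℝ (Fin d)) :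
    ‖∫ z, Complex.exp (-(Complex.I * ((⟪-ξ, z⟫ : ℝ) : ℂ))) * (g z : ℂ) ∂μ‖ =
      ‖∫ z, Complex.exp (-(Complex.I * ((⟪ξ, z⟫ : ℝ) : ℂ))) * (g z : ℂ) ∂μ‖ := by
  rw [← RCLike.norm_conj (∫ z, Complex.exp (-(Complex.I * ((⟪ξ, z⟫ : ℝ) : ℂ))) * (g z : ℂ) ∂μ),
    ← integral_conj]
  congr 2
  ext z
  simp [← Complex.exp_conj]

/-- The change of variables `a = s + b` in a trilinear integral. -/
lemma lintegral_lintegral_sub_eq_lintegral_lintegral_add {d : ℕ}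
    {n a b : EuclideanSpace ℝ (Fin d) → ℝ≥0∞}
    (hn : Measurable n) (ha : Measurable a) (hb : Measurable b) :
    ∫⁻ p : EuclideanSpace ℝ (Fin d) × EuclideanSpace ℝ (Fin d), n (p.1 - p.2) * (a p.1 * b p.2) =
      ∫⁻ s, n s * ∫⁻ l, a (s + l) * b l := by
  rw [Measure.volume_eq_prod, lintegral_prod_symm' _ (by fun_prop)]
  have hshift (l : EuclideanSpace ℝ (Fin d)) :
      ∫⁻ ξ, n (ξ - l) * (a ξ * b l) = ∫⁻ s, n s * (a (s + l) * b l) := by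
    rw [← lintegral_add_right_eq_self _ l]
    simp
  simp only [hshift]
  rw [lintegral_lintegral_swap (by fun_prop)]
  refine lintegral_congr fun s => ?_
  rw [lintegral_const_mul _ (by fun_prop)]

/-- Inequality (exc.2q): for continuous integrable `u, h : ℝ^d → ℝ` with integrable
Fourier transforms `û, ĥ` (so that `u` and `h` are recovered by Fourier inversion), and
a finite signed measure `ν = f • μ` (with `|f| = 1`) with Fourier transform `ν̂`,
`sup_{x,y} |∫ u(z−y) h(x−z) dν(z)| ≤ (2π)^{−d} ∫ |ν̂(s)| (∫ |û(s+λ)| |ĥ(λ)| dλ) ds`. -/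
theorem stmt_19 (d : ℕ)
    (u h : EuclideanSpace ℝ (Fin d) → ℝ)
    (hu_cont : Continuous u) (hh_cont : Continuous h)
    (hu_int : Integrable u volume) (hh_int : Integrable h volume)
    (uhat hhat : EuclideanSpace ℝ (Fin d) → ℂ)
    (huhat : ∀ ξ, uhat ξ =
      ∫ z, Complex.exp (-(Complex.I * ((⟪ξ, z⟫ : ℝ) : ℂ))) * (u z : ℂ))
    (hhhat : ∀ ξ, hhat ξ =
      ∫ z, Complex.exp (-(Complex.I * ((⟪ξ, z⟫ : ℝ) : ℂ))) * (h z : ℂ))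
    (huhat_int : Integrable uhat volume) (hhhat_int : Integrable hhat volume)
    (hu_inv : ∀ z, (u z : ℂ) = (((2 * Real.pi) ^ (-(d : ℤ)) : ℝ) : ℂ) *
      ∫ ξ, Complex.exp (Complex.I * ((⟪z, ξ⟫ : ℝ) : ℂ)) * uhat ξ)
    (hh_inv : ∀ z, (h z : ℂ) = (((2 * Real.pi) ^ (-(d : ℤ)) : ℝ) : ℂ) *
      ∫ ξ, Complex.exp (Complex.I * ((⟪z, ξ⟫ : ℝ) : ℂ)) * hhat ξ)
    (μ : Measure (EuclideanSpace ℝ (Fin d))) [IsFiniteMeasure μ]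
    (f : EuclideanSpace ℝ (Fin d) → ℝ) (hf_meas : Measurable f) (hf : ∀ x, |f x| = 1)
    (νhat : EuclideanSpace ℝ (Fin d) → ℂ)
    (hνhat : ∀ ξ, νhat ξ =
      ∫ z, Complex.exp (-(Complex.I * ((⟪ξ, z⟫ : ℝ) : ℂ))) * (f z : ℂ) ∂μ) :
    ∀ x y : EuclideanSpace ℝ (Fin d),
      ENNReal.ofReal |∫ z, u (z - y) * h (x - z) * f z ∂μ|
        ≤ ENNReal.ofReal ((2 * Real.pi) ^ (-(d : ℤ))) *
            ∫⁻ s, (‖νhat s‖₊ : ℝ≥0∞) *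
              ∫⁻ l, (‖uhat (s + l)‖₊ : ℝ≥0∞) * (‖hhat l‖₊ : ℝ≥0∞) := by
  intro x y
  set c : ℝ := (2 * Real.pi) ^ (-(d : ℤ)) with hc
  have hc0 : 0 ≤ c := by positivity
  have hc1 : c ≤ 1 := by
    rw [hc]
    exact zpow_le_one_of_nonpos₀ (by linarith [Real.pi_gt_three]) (by simp)
  have hum : Measurable uhat := by
    rw [funext huhat]
    exact measurable_integral_cexp_neg_inner_mul volume hu_cont.measurable
  have hhm : Measurable hhat := by
    rw [funext hhhat]
    exact measurable_integral_cexp_neg_inner_mul volume hh_cont.measurable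
  have hνm : Measurable νhat := by
    rw [funext hνhat]
    exact measurable_integral_cexp_neg_inner_mul μ hf_meas
  have hνeven (ξ) : ‖νhat (-ξ)‖ = ‖νhat ξ‖ := by
    rw [hνhat, hνhat, norm_integral_cexp_neg_inner_mul_neg]
  let E := EuclideanSpace ℝ (Fin d)
  let e : E → E × E → ℂ := fun z p =>
    Complex.exp ((⟪z - y, p.1⟫ + ⟪x - z, p.2⟫ : ℝ) * Complex.I)
  let F : E → E × E → ℂ := fun z p => e z p * ((f z : ℂ) * (uhat p.1 * hhat p.2))
  have hpoint (z : E) :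
      ((u (z - y) * h (x - z) * f z : ℝ) : ℂ) = ((c * c : ℝ) : ℂ) * ∫ p, F z p := by
    have hprod := integral_prod_mul (μ := (volume : Measure E)) (ν := (volume : Measure E))
      (fun a => Complex.exp (Complex.I * ((⟪z - y, a⟫ : ℝ) : ℂ)) * uhat a)
      (fun b => Complex.exp (Complex.I * ((⟪x - z, b⟫ : ℝ) : ℂ)) * hhat b)
    have hF : ∫ p, F z p = (f z : ℂ) * ∫ p : E × E,
        (Complex.exp (Complex.I * ((⟪z - y, p.1⟫ : ℝ) : ℂ)) * uhat p.1) *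
        (Complex.exp (Complex.I * ((⟪x - z, p.2⟫ : ℝ) : ℂ)) * hhat p.2) := by
      rw [← integral_const_mul]
      refine integral_congr_ae (.of_forall fun p => ?_)
      simp only [F, e, Complex.ofReal_add, add_mul, Complex.exp_add, mul_comm Complex.I]
      ring
    rw [hF, Measure.volume_eq_prod, hprod]
    push_cast
    rw [hu_inv, hh_inv]
    ring
  have hint : Integrable (Function.uncurry F) (μ.prod volume) := by
    have hfi : Integrable (fun z => (f z : ℂ)) μ := by
      refine Integrable.of_bound (Complex.measurable_ofReal.comp hf_meas).aestronglyMeasurable 1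
        (.of_forall fun z => ?_)
      simp [hf]
    refine (hfi.mul_prod (huhat_int.mul_prod hhhat_int)).bdd_mul (c := 1)
      (Continuous.aestronglyMeasurable (by fun_prop)) (.of_forall fun q => ?_)
    exact (Complex.norm_exp_ofReal_mul_I _).le
  have hinner (p : E × E) :
      ‖∫ z, F z p ∂μ‖ₑ = ‖νhat (p.1 - p.2)‖ₑ * (‖uhat p.1‖ₑ * ‖hhat p.2‖ₑ) := by
    have hF : ∫ z, F z p ∂μ =
        Complex.exp ((⟪x, p.2⟫ - ⟪y, p.1⟫ : ℝ) * Complex.I) * (uhat p.1 * hhat p.2) *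
          νhat (-(p.1 - p.2)) := by
      rw [hνhat, ← integral_const_mul]
      refine integral_congr_ae (.of_forall fun z => ?_)
      have he : e z p = Complex.exp ((⟪x, p.2⟫ - ⟪y, p.1⟫ : ℝ) * Complex.I) *
          Complex.exp (-(Complex.I * ((⟪-(p.1 - p.2), z⟫ : ℝ) : ℂ))) := by
        rw [← Complex.exp_add]
        simp only [e, inner_sub_left, inner_neg_left]
        rw [real_inner_comm p.1 z, real_inner_comm p.2 z]
        push_cast
        ring_nf
      simp only [F, he]
      ring
    rw [← enorm_mul, ← enorm_mul, hF, ← ofReal_norm, ← ofReal_norm]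
    simp only [norm_mul, Complex.norm_exp_ofReal_mul_I, hνeven, one_mul]
    rw [mul_comm]
  have hmain : ((∫ z, u (z - y) * h (x - z) * f z ∂μ : ℝ) : ℂ) =
      ((c * c : ℝ) : ℂ) * ∫ p, ∫ z, F z p ∂μ := by
    rw [← integral_complex_ofReal, ← integral_integral_swap hint, ← integral_const_mul]
    exact integral_congr_ae (.of_forall hpoint)
  calc ENNReal.ofReal |∫ z, u (z - y) * h (x - z) * f z ∂μ|
      = ‖((c * c : ℝ) : ℂ) * ∫ p, ∫ z, F z p ∂μ‖ₑ := by
        rw [← hmain, ← ofReal_norm, Complex.norm_real, Real.norm_eq_abs]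
    _ = ENNReal.ofReal (c * c) * ‖∫ p, ∫ z, F z p ∂μ‖ₑ := by
        rw [enorm_mul, ← ofReal_norm, Complex.norm_real, Real.norm_of_nonneg (by positivity)]
    _ ≤ ENNReal.ofReal c * ∫⁻ p, ‖∫ z, F z p ∂μ‖ₑ := by
        gcongr
        · exact mul_le_of_le_one_left hc0 hc1
        · exact enorm_integral_le_lintegral_enorm _
    _ = _ := by
        simp only [hinner]
        rw [lintegral_lintegral_sub_eq_lintegral_lintegral_add hνm.enorm hum.enorm hhm.enorm]
        rfl
end
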